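/- Let (W,S) be a finite Coxeter system with longest element w0, let I ⊆ J ⊆ S, and let I⁺ = {v ∈ S : iv ≠ vi for some i ∈ I}. Then D_R(w0 · w0(J^c) · w0(I)) = (J ∪ I⁺) \ I, where J^c = S \ J. -/

import Mathlib

open Polynomial

namespace CoxeterCharPoly

variable {B W : Type*} [Group W] {M : CoxeterMatrix B}

/-- The left weak order on a Coxeter group. -/
def wle (cs : CoxeterSystem M W) (u w : W) : Prop :=
  cs.length w = cs.length (w * u⁻¹) + cs.length u

/-- The standard parabolic subgroup generated by `J ⊆ S`. -/
def parabolic (cs : CoxeterSystem M W) (J : Set B) : Subgroup W :=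
  Subgroup.closure (cs.simple '' J)

/- The longest element of the parabolic subgroup `W_J` (junk value if there is
no element of maximal length). -/
open Classical in
noncomputable def w0 (cs : CoxeterSystem M W) (J : Set B) : W :=
  if h : ∃ w ∈ parabolic cs J, ∀ u ∈ parabolic cs J, cs.length u ≤ cs.length w
  then h.choose else 1

/-- The right descent set of `w`, as a subset of `B`. -/
def rightDescents (cs : CoxeterSystem M W) (w : W) : Set B :=
  {i | cs.IsRightDescent w i}

/- `μ` is the Möbius function of the subposet `A` of the order `le`. -/
open Classical in
def IsMobiusOn {α : Type*} (le : α → α → Prop) (A : Set α) (μ : α → α → ℤ) : Prop :=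
  ∀ a ∈ A, ∀ b ∈ A, le a b →
    (∑ᶠ t ∈ {t | t ∈ A ∧ le a t ∧ le t b}, μ a t) = if a = b then 1 else 0

open CoxeterSystem

section Geometric

/-- The simple coroot attached to `i`, as a linear form on the space spanned by the simple roots. -/
noncomputable def simpleCoroot (M : CoxeterMatrix B) (i : B) : Module.Dual ℝ (B →₀ ℝ) :=
  Finsupp.linearCombination ℝ fun j => -(2 * Real.cos (Real.pi / M i j))

lemma simpleCoroot_single (M : CoxeterMatrix B) (i j : B) :
    simpleCoroot M i (Finsupp.single j 1) = -(2 * Real.cos (Real.pi / M i j)) := by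
  simp [simpleCoroot]

lemma simpleCoroot_single_self (M : CoxeterMatrix B) (i : B) :
    simpleCoroot M i (Finsupp.single i 1) = 2 := by
  simp [simpleCoroot_single]

/-- The simple reflection attached to `i` in the geometric representation. -/
noncomputable def geomReflection (M : CoxeterMatrix B) (i : B) : (B →₀ ℝ) ≃ₗ[ℝ] (B →₀ ℝ) :=
  Module.reflection (simpleCoroot_single_self M i)

lemma geomReflection_apply (M : CoxeterMatrix B) (i : B) (v : B →₀ ℝ) :
    geomReflection M i v = v - simpleCoroot M i v • Finsupp.single i 1 :=
  Module.reflection_apply _ _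

lemma geomReflection_isLiftable (M : CoxeterMatrix B) :
    M.IsLiftable (geomReflection M) := by
  intro i j
  rcases eq_or_ne i j with rfl | hij
  · rw [M.diagonal, pow_one]
    ext1 v
    exact Module.involutive_reflection (simpleCoroot_single_self M i) v
  have h1 : M i j ≠ 1 := M.off_diagonal i j hij
  rcases Nat.lt_or_ge (M i j) 3 with h3 | h3
  · have h02 : M i j = 0 ∨ M i j = 2 := by omega
    rcases h02 with h0 | h2
    · rw [h0, pow_zero]
    · have hf : simpleCoroot M i (Finsupp.single j 1) = 0 := by simp [simpleCoroot_single, h2]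
      have hg : simpleCoroot M j (Finsupp.single i 1) = 0 := by
        simp [simpleCoroot_single, M.symmetric j i, h2]
      rw [h2, pow_two]
      refine LinearEquiv.ext fun v => ?_
      simp only [LinearEquiv.mul_apply, geomReflection_apply, map_sub, map_smul, hf, hg,
        simpleCoroot_single_self, LinearEquiv.coe_one, id_eq]
      module
  set m := M i j with hm
  set θ : ℝ := 2 * Real.pi / m with hθ
  have hm0 : (0 : ℝ) < m := by positivity
  have hmθ : m * θ = 2 * Real.pi := by rw [hθ]; field_simp
  have hsin : Real.sin θ ≠ 0 := by
    refine (Real.sin_pos_of_pos_of_lt_pi (by positivity) ?_).ne'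
    have : (3 : ℝ) ≤ m := by exact_mod_cast h3
    nlinarith [Real.pi_pos]
  have ht : 2 * Real.cos θ = simpleCoroot M i (Finsupp.single j 1) *
      simpleCoroot M j (Finsupp.single i 1) - 2 := by
    rw [simpleCoroot_single, simpleCoroot_single, M.symmetric j i, ← hm,
      show θ = 2 * (Real.pi / m) by rw [hθ]; ring, Real.cos_two_mul]
    ring
  refine LinearEquiv.ext fun v => ?_
  have key := Module.reflection_mul_reflection_pow_apply (simpleCoroot_single_self M i)
    (simpleCoroot_single_self M j) m v (2 * Real.cos θ) ht
  refine key.trans ?_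
  have hS := fun n : ℤ => Polynomial.Chebyshev.S_two_mul_real_cos θ n
  rcases Nat.even_or_odd' m with ⟨k, hk | hk⟩
  · have hzero : (Polynomial.Chebyshev.S ℝ (k - 1)).eval (2 * Real.cos θ) = 0 := by
      refine (mul_eq_zero.mp ?_).resolve_right hsin
      rw [hS]
      have : (((k : ℤ) - 1 : ℤ) + 1 : ℝ) * θ = Real.pi := by
        push_cast
        rw [hk] at hmθ
        push_cast at hmθ
        linarith
      rw [this, Real.sin_pi]
    rw [show ((m : ℤ) - 2) / 2 = k - 1 by omega, show ((m : ℤ) - 1) / 2 = k - 1 by omega, hzero]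
    simp
  · have hzero : (Polynomial.Chebyshev.S ℝ k).eval (2 * Real.cos θ) +
        (Polynomial.Chebyshev.S ℝ (k - 1)).eval (2 * Real.cos θ) = 0 := by
      refine (mul_eq_zero.mp ?_).resolve_right hsin
      rw [add_mul, hS, hS]
      have : (((k : ℤ) : ℝ) + 1) * θ = 2 * Real.pi - (((k : ℤ) - 1 : ℤ) + 1 : ℝ) * θ := by
        push_cast
        rw [hk] at hmθ
        push_cast at hmθ
        linarith
      rw [this, Real.sin_two_pi_sub]
      ring
    rw [show ((m : ℤ) - 2) / 2 = k - 1 by omega, show ((m : ℤ) - 1) / 2 = k by omega,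
      show ((m : ℤ) - 3) / 2 = k - 1 by omega, show (m : ℤ) / 2 = k by omega, hzero]
    simp

/-- The geometric representation of a Coxeter group. -/
noncomputable def geomRep (cs : CoxeterSystem M W) : W →* ((B →₀ ℝ) ≃ₗ[ℝ] (B →₀ ℝ)) :=
  cs.lift ⟨geomReflection M, geomReflection_isLiftable M⟩

lemma geomRep_simple (cs : CoxeterSystem M W) (i : B) :
    geomRep cs (cs.simple i) = geomReflection M i :=
  cs.lift_apply_simple _ i

lemma geomRep_apply_of_mem_parabolic (cs : CoxeterSystem M W) {J : Set B} {w : W}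
    (hw : w ∈ parabolic cs J) {j : B} (hj : j ∉ J) (v : B →₀ ℝ) : geomRep cs w v j = v j := by
  induction hw using Subgroup.closure_induction generalizing v with
  | mem x hx =>
    obtain ⟨i, hi, rfl⟩ := hx
    have hij : i ≠ j := fun h => hj (h ▸ hi)
    simp [geomRep_simple, geomReflection_apply, hij]
  | one => simp
  | mul x y _ _ hx hy => rw [map_mul, LinearEquiv.mul_apply, hx, hy]
  | inv x _ hx =>
    rw [← hx, ← LinearEquiv.mul_apply, ← map_mul, mul_inv_cancel, map_one]
    rfl

lemma simple_mem_parabolic_iff (cs : CoxeterSystem M W) {J : Set B} {b : B} :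
    cs.simple b ∈ parabolic cs J ↔ b ∈ J := by
  refine ⟨fun h => ?_, fun h => Subgroup.subset_closure ⟨b, h, rfl⟩⟩
  by_contra hb
  have := geomRep_apply_of_mem_parabolic cs h hb (Finsupp.single b 1)
  rw [geomRep_simple, geomReflection_apply, simpleCoroot_single_self] at this
  norm_num at this

lemma geomRep_ne_one_of_isReflection (cs : CoxeterSystem M W) {t : W}
    (ht : cs.IsReflection t) : geomRep cs t ≠ 1 := by
  obtain ⟨w, i, rfl⟩ := ht
  intro h
  rw [map_mul, map_mul, map_inv, conj_eq_one_iff, geomRep_simple] at h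
  have := DFunLike.congr_fun (LinearEquiv.congr_fun h (Finsupp.single i 1)) i
  rw [geomReflection_apply, simpleCoroot_single_self] at this
  norm_num at this

lemma notMem_parabolic_of_disjoint (cs : CoxeterSystem M W) {I J : Set B} (hIJ : Disjoint I J)
    {t : W} (ht : cs.IsReflection t) (hI : t ∈ parabolic cs I) : t ∉ parabolic cs J := by
  refine fun hJ => geomRep_ne_one_of_isReflection cs ht ?_
  refine LinearEquiv.ext fun v => Finsupp.ext fun j => ?_
  by_cases hj : j ∈ I
  · exact geomRep_apply_of_mem_parabolic cs hJ (Set.disjoint_left.mp hIJ hj) v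
  · exact geomRep_apply_of_mem_parabolic cs hI hj v

end Geometric

section InversionParity

lemma end_mul_apply {α : Type*} (f g : Function.End α) (a : α) : (f * g) a = f (g a) := rfl

open Classical in
/-- The action of the simple reflection `i` on signed elements of `W`: conjugation by `s i`,
flipping the sign of `s i` itself. -/
noncomputable def signedConj (cs : CoxeterSystem M W) (i : B) : Function.End (W × ZMod 2) :=
  fun p => (cs.simple i * p.1 * cs.simple i, p.2 + if p.1 = cs.simple i then 1 else 0)

open Classical in
lemma signedConj_mul_pow_apply (cs : CoxeterSystem M W) (i j : B) (k : ℕ) (p : W × ZMod 2) :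
    ((signedConj cs i * signedConj cs j) ^ k) p =
      ((cs.simple i * cs.simple j) ^ k * p.1 * ((cs.simple i * cs.simple j) ^ k)⁻¹,
        p.2 + ∑ r ∈ Finset.range (2 * k),
          if p.1 = cs.simple j * (cs.simple i * cs.simple j) ^ r then 1 else 0) := by
  induction k with
  | zero => simp [Function.End.one_def]
  | succ k ih =>
    set a := cs.simple i * cs.simple j with ha
    have ha' : a⁻¹ = cs.simple j * cs.simple i := by simp [ha]
    have hsemi : SemiconjBy (cs.simple j) a a⁻¹ := by
      rw [SemiconjBy, ha', ha, mul_assoc]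
    have hpow : cs.simple j * a ^ k = (a ^ k)⁻¹ * cs.simple j := by
      rw [← inv_pow]; exact hsemi.pow_right k
    have e1 : a ^ k * p.1 * (a ^ k)⁻¹ = cs.simple j ↔ p.1 = cs.simple j * a ^ (2 * k) := by
      rw [two_mul, pow_add, ← mul_assoc, hpow, mul_inv_eq_iff_eq_mul, mul_assoc,
        eq_inv_mul_iff_mul_eq]
    have e2 : cs.simple j * (a ^ k * p.1 * (a ^ k)⁻¹) * cs.simple j = cs.simple i ↔
        p.1 = cs.simple j * a ^ (2 * k + 1) := by
      have h1 : cs.simple j * a ^ (2 * k + 1) =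
          (a ^ k)⁻¹ * (cs.simple j * cs.simple i * cs.simple j) * a ^ k := by
        rw [show 2 * k + 1 = k + (1 + k) by ring, pow_add, pow_add, pow_one, ← mul_assoc, hpow, ha]
        simp only [mul_assoc]
      have h2 (x : W) : cs.simple j * x * cs.simple j = cs.simple i ↔
          x = cs.simple j * cs.simple i * cs.simple j :=
        ⟨fun h => by simp [← h, mul_assoc], fun h => by simp [h, mul_assoc]⟩
      rw [h2, h1, mul_inv_eq_iff_eq_mul, mul_assoc (a ^ k)⁻¹,
        eq_inv_mul_iff_mul_eq]
    rw [pow_succ', end_mul_apply, ih, end_mul_apply]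
    simp only [signedConj]
    rw [show 2 * (k + 1) = 2 * k + 1 + 1 by ring, Finset.sum_range_succ, Finset.sum_range_succ]
    refine Prod.ext ?_ ?_
    · simp only [pow_succ', ha, mul_inv_rev, cs.inv_simple, mul_assoc]
    · simp only [e1, e2, add_assoc]

lemma signedConj_isLiftable (cs : CoxeterSystem M W) : M.IsLiftable (signedConj cs) := by
  classical
  intro i j
  funext p
  rw [signedConj_mul_pow_apply, cs.simple_mul_simple_pow, two_mul, Finset.sum_range_add]
  simp only [pow_add, cs.simple_mul_simple_pow, one_mul, CharTwo.add_self_eq_zero]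
  simp [Function.End.one_def]

/-- The action of `W` on signed elements of `W`. -/
noncomputable def signedConjHom (cs : CoxeterSystem M W) : W →* Function.End (W × ZMod 2) :=
  cs.lift ⟨signedConj cs, signedConj_isLiftable cs⟩

/-- The parity of the multiplicity of `t` in the right inversion sequence of any word for `w`. -/
noncomputable def inversionParity (cs : CoxeterSystem M W) (w t : W) : ZMod 2 :=
  (signedConjHom cs w (t, 0)).2

lemma signedConjHom_simple (cs : CoxeterSystem M W) (i : B) :
    signedConjHom cs (cs.simple i) = signedConj cs i :=
  cs.lift_apply_simple _ i

lemma signedConjHom_apply (cs : CoxeterSystem M W) (w t : W) (ε : ZMod 2) :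
    signedConjHom cs w (t, ε) = (w * t * w⁻¹, ε + inversionParity cs w t) := by
  induction w using cs.simple_induction_left generalizing t ε with
  | one => simp [inversionParity, Function.End.one_def]
  | mul_simple_left w i ih =>
    rw [inversionParity, map_mul, end_mul_apply, end_mul_apply, ih, ih, zero_add,
      signedConjHom_simple]
    simp only [signedConj, mul_inv_rev, cs.inv_simple, mul_assoc, add_assoc]

@[simp]
lemma inversionParity_one (cs : CoxeterSystem M W) (t : W) : inversionParity cs 1 t = 0 := by
  simp [inversionParity, Function.End.one_def]

open Classical in
lemma inversionParity_simple (cs : CoxeterSystem M W) (i : B) (t : W) :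
    inversionParity cs (cs.simple i) t = if t = cs.simple i then 1 else 0 := by
  simp [inversionParity, signedConjHom_simple, signedConj]

lemma inversionParity_mul (cs : CoxeterSystem M W) (x y t : W) :
    inversionParity cs (x * y) t =
      inversionParity cs y t + inversionParity cs x (y * t * y⁻¹) := by
  rw [inversionParity, map_mul, end_mul_apply, signedConjHom_apply,
    signedConjHom_apply, zero_add]

lemma inversionParity_inv (cs : CoxeterSystem M W) (x t : W) :
    inversionParity cs x⁻¹ t = inversionParity cs x (x⁻¹ * t * x) := by
  have h := inversionParity_mul cs x x⁻¹ t
  rw [mul_inv_cancel, inversionParity_one, inv_inv] at h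
  exact CharTwo.add_eq_zero.mp h.symm

lemma inversionParity_self (cs : CoxeterSystem M W) {t : W} (ht : cs.IsReflection t) :
    inversionParity cs t t = 1 := by
  obtain ⟨w, i, rfl⟩ := ht
  have h1 : w⁻¹ * (w * cs.simple i * w⁻¹) * w = cs.simple i := by group
  have h2 : w⁻¹ * (w * cs.simple i * w⁻¹) * w⁻¹⁻¹ = cs.simple i := by group
  rw [inversionParity_mul, inversionParity_mul, inversionParity_inv, h1, h2,
    inversionParity_simple, if_pos rfl, mul_inv_cancel_right, add_left_comm,
    CharTwo.add_self_eq_zero, add_zero]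

lemma inversionParity_wordProd_eq_zero (cs : CoxeterSystem M W) {ω : List B} {t : W}
    (ht : t ∉ cs.rightInvSeq ω) : inversionParity cs (cs.wordProd ω) t = 0 := by
  induction ω with
  | nil => simp
  | cons i ω ih =>
    rw [rightInvSeq, List.mem_cons, not_or] at ht
    rw [cs.wordProd_cons, inversionParity_mul, ih ht.2, inversionParity_simple, if_neg, add_zero]
    intro h
    apply ht.1
    rw [← h]
    group

lemma length_mul_lt_iff (cs : CoxeterSystem M W) {w t : W} (ht : cs.IsReflection t) :
    cs.length (w * t) < cs.length w ↔ inversionParity cs w t = 1 := by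
  have aux : ∀ u : W, inversionParity cs u t ≠ 0 → cs.length (u * t) < cs.length u := by
    intro u hu
    obtain ⟨ω, hω, rfl⟩ := cs.exists_isReduced u
    by_contra hlt
    exact hu (inversionParity_wordProd_eq_zero cs
      fun hmem => hlt (cs.isRightInversion_of_mem_rightInvSeq hω hmem).2)
  refine ⟨fun hlt => ?_, fun h => aux w (by simp [h])⟩
  by_contra hne
  have h0 : inversionParity cs w t = 0 := by
    generalize inversionParity cs w t = z at hne
    revert z
    decide
  have := aux (w * t) (by
    rw [inversionParity_mul, inversionParity_self cs ht, mul_inv_cancel_right, h0]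
    decide)
  rw [mul_assoc, ht.mul_self, mul_one] at this
  exact lt_asymm hlt this

lemma inversionParity_eq_zero_of_notMem (cs : CoxeterSystem M W) {J : Set B} {w t : W}
    (hw : w ∈ parabolic cs J) (ht : t ∉ parabolic cs J) : inversionParity cs w t = 0 := by
  induction hw using Subgroup.closure_induction generalizing t with
  | mem x hx =>
    obtain ⟨i, hi, rfl⟩ := hx
    rw [inversionParity_simple, if_neg]
    rintro rfl
    exact ht ((simple_mem_parabolic_iff cs).mpr hi)
  | one => simp
  | mul x y _ hy ihx ihy =>
    rw [inversionParity_mul, ihy ht, ihx, add_zero]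
    change y ∈ parabolic cs J at hy
    rwa [Subgroup.mul_mem_cancel_right _ (inv_mem hy), Subgroup.mul_mem_cancel_left _ hy]
  | inv x hx ih =>
    change x ∈ parabolic cs J at hx
    rw [inversionParity_inv, ih]
    rwa [Subgroup.mul_mem_cancel_right _ hx, Subgroup.mul_mem_cancel_left _ (inv_mem hx)]

end InversionParity

section LongestElement

variable [Finite W]

lemma w0_spec (cs : CoxeterSystem M W) (J : Set B) :
    w0 cs J ∈ parabolic cs J ∧ ∀ u ∈ parabolic cs J, cs.length u ≤ cs.length (w0 cs J) := by
  have h : ∃ w ∈ parabolic cs J, ∀ u ∈ parabolic cs J, cs.length u ≤ cs.length w :=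
    Set.exists_max_image (parabolic cs J : Set W) cs.length (Set.toFinite _) ⟨1, one_mem _⟩
  rw [w0, dif_pos h]
  exact h.choose_spec

lemma inversionParity_w0 (cs : CoxeterSystem M W) {J : Set B} {t : W} (ht : cs.IsReflection t)
    (hJ : t ∈ parabolic cs J) : inversionParity cs (w0 cs J) t = 1 := by
  rw [← length_mul_lt_iff cs ht]
  obtain ⟨hmem, hmax⟩ := w0_spec cs J
  exact lt_of_le_of_ne (hmax _ (mul_mem hmem hJ)) (ht.length_mul_left_ne _)

lemma isRightDescent_w0_univ_mul_iff (cs : CoxeterSystem M W) (u : W) (b : B) :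
    cs.IsRightDescent (w0 cs Set.univ * u) b ↔ inversionParity cs u (cs.simple b) = 0 := by
  have hb := cs.isReflection_simple b
  have htop : parabolic cs Set.univ = ⊤ := by
    rw [parabolic, Set.image_univ, cs.subgroup_closure_range_simple]
  rw [IsRightDescent, length_mul_lt_iff cs hb, inversionParity_mul,
    inversionParity_w0 cs (hb.conj u) (htop ▸ Subgroup.mem_top _), add_eq_right]

end LongestElement

lemma commute_of_conj_mem_parabolic (cs : CoxeterSystem M W) {I : Set B} {b i : B} (hb : b ∉ I)
    (h : cs.simple b * cs.simple i * cs.simple b ∈ parabolic cs I) :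
    cs.simple i * cs.simple b = cs.simple b * cs.simple i := by
  have h0 := inversionParity_eq_zero_of_notMem cs h
    (mt (simple_mem_parabolic_iff cs).mp hb)
  by_contra hne
  have hbi : cs.simple b ≠ cs.simple i := fun e => hne (by rw [e])
  have hcomm : cs.simple i * cs.simple b * cs.simple i ≠ cs.simple b := by
    intro e
    apply hne
    conv_rhs => rw [← e]
    simp
  rw [inversionParity_mul, inversionParity_mul, inversionParity_simple, inversionParity_simple,
    inversionParity_simple] at h0
  simp [hbi, hcomm] at h0

lemma conj_simple_of_commute (cs : CoxeterSystem M W) {I : Set B} {b : B} {y : W}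
    (hy : y ∈ parabolic cs I)
    (hcomm : ∀ i ∈ I, cs.simple i * cs.simple b = cs.simple b * cs.simple i) :
    y * cs.simple b * y⁻¹ = cs.simple b := by
  have hle : parabolic cs I ≤ Subgroup.centralizer {cs.simple b} := by
    rw [parabolic, Subgroup.closure_le]
    rintro _ ⟨i, hi, rfl⟩
    rw [SetLike.mem_coe, Subgroup.mem_centralizer_singleton_iff]
    exact hcomm i hi
  rw [mul_inv_eq_iff_eq_mul]
  exact Subgroup.mem_centralizer_singleton_iff.mp (hle hy)

lemma conj_w0_mem_parabolic_iff (cs : CoxeterSystem M W) [Finite W] {I K : Set B}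
    (hIK : Disjoint I K) {b : B} (hb : b ∉ I) :
    w0 cs I * cs.simple b * (w0 cs I)⁻¹ ∈ parabolic cs K ↔
      b ∈ K ∧ ∀ i ∈ I, cs.simple i * cs.simple b = cs.simple b * cs.simple i := by
  obtain ⟨hy, -⟩ := w0_spec cs I
  set y := w0 cs I with hydef
  constructor
  · intro h
    have hcomm : ∀ i ∈ I, cs.simple i * cs.simple b = cs.simple b * cs.simple i := by
      intro i hi
      apply commute_of_conj_mem_parabolic cs hb
      by_contra hmem
      have hiI := (simple_mem_parabolic_iff cs).mpr hi
      have hne : cs.simple i ≠ cs.simple b := fun e =>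
        hb ((simple_mem_parabolic_iff cs).mp (e ▸ hiI))
      have hri := cs.isReflection_simple i
      have h1 : inversionParity cs (y * cs.simple b) (cs.simple i) = 0 := by
        rw [inversionParity_mul, cs.inv_simple, inversionParity_eq_zero_of_notMem cs hy hmem,
          inversionParity_simple, if_neg hne, add_zero]
      have h2 : inversionParity cs (y * cs.simple b * y⁻¹ * y) (cs.simple i) = 1 := by
        rw [inversionParity_mul, hydef, inversionParity_w0 cs hri hiI, ← hydef,
          inversionParity_eq_zero_of_notMem cs h (notMem_parabolic_of_disjoint cs hIK (hri.conj y)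
            (mul_mem (mul_mem hy hiI) (inv_mem hy))), add_zero]
      rw [inv_mul_cancel_right, h1] at h2
      exact zero_ne_one h2
    refine ⟨?_, hcomm⟩
    rwa [conj_simple_of_commute cs hy hcomm, simple_mem_parabolic_iff] at h
  · rintro ⟨hK, hcomm⟩
    rwa [conj_simple_of_commute cs hy hcomm, simple_mem_parabolic_iff]

lemma inversionParity_w0_mul_w0 (cs : CoxeterSystem M W) [Finite W] {I K : Set B}
    (hIK : Disjoint I K) (b : B) :
    inversionParity cs (w0 cs K * w0 cs I) (cs.simple b) = 0 ↔
      b ∉ I ∧ ¬(b ∈ K ∧ ∀ i ∈ I, cs.simple i * cs.simple b = cs.simple b * cs.simple i) := by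
  have hrb := cs.isReflection_simple b
  obtain ⟨hy, -⟩ := w0_spec cs I
  obtain ⟨hx, -⟩ := w0_spec cs K
  rw [inversionParity_mul]
  by_cases hb : b ∈ I
  · have hbI := (simple_mem_parabolic_iff cs).mpr hb
    rw [inversionParity_w0 cs hrb hbI, inversionParity_eq_zero_of_notMem cs hx
      (notMem_parabolic_of_disjoint cs hIK (hrb.conj _)
        (mul_mem (mul_mem hy hbI) (inv_mem hy)))]
    simp [hb]
  · rw [inversionParity_eq_zero_of_notMem cs hy (mt (simple_mem_parabolic_iff cs).mp hb), zero_add,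
      ← conj_w0_mem_parabolic_iff cs hIK hb]
    by_cases hmem : w0 cs I * cs.simple b * (w0 cs I)⁻¹ ∈ parabolic cs K
    · simp [inversionParity_w0 cs (hrb.conj _) hmem, hmem]
    · simp [inversionParity_eq_zero_of_notMem cs hx hmem, hmem, hb]

/-- in a finite Coxeter group, for `I ⊆ J ⊆ S` and
`I⁺ = {v ∈ S : iv ≠ vi for some i ∈ I}`, we have
`D_R(w0 · w0(Jᶜ) · w0(I)) = (J ∪ I⁺) \ I`. -/
theorem descents_w0w0Jc_w0I (cs : CoxeterSystem M W) [Finite W]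
    (I J : Set B) (hIJ : I ⊆ J) :
    rightDescents cs (w0 cs Set.univ * w0 cs Jᶜ * w0 cs I) =
      (J ∪ {b : B | ∃ i ∈ I, cs.simple i * cs.simple b ≠ cs.simple b * cs.simple i}) \ I := by
  have hdisj : Disjoint I Jᶜ := Set.disjoint_compl_right_iff_subset.mpr hIJ
  ext b
  rw [rightDescents, Set.mem_ofPred_eq, mul_assoc, isRightDescent_w0_univ_mul_iff,
    inversionParity_w0_mul_w0 cs hdisj]
  simp only [Set.mem_sdiff, Set.mem_union, Set.mem_compl_iff, Set.mem_ofPred_eq, not_and, not_forall,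
    exists_prop, ne_eq]
  tauto

end CoxeterCharPoly
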